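/- Let Γ be a group with a finite symmetric generating set S whose word balls satisfy |B(n)| ≤ C·n^d for all n ≥ 1, for some constants C > 0 and d ≥ 0, and let Γ act by homeomorphisms on a compact metrizable space X. Then there exists m ∈ ℕ such that the action has weak m-comparison. -/

import Mathlib

open MeasureTheory Pointwise

/-- The word ball of radius `n` with respect to a generating set `S`:
elements expressible as a product of at most `n` elements of `S` (so `B 0 = {1}`). -/
def wordBall {Γ : Type*} [Group Γ] (S : Set Γ) (n : ℕ) : Set Γ :=
  {g : Γ | ∃ l : List Γ, (∀ x ∈ l, x ∈ S) ∧ l.length ≤ n ∧ l.prod = g}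

/-- `A ≼_m B`: there are finitely many open sets `U j` covering `A`, group elements `g j`
with `g j • U j ⊆ B`, and a colouring `c` with `m + 1` colours such that translates of the
same colour are disjoint. -/
def SubEquiv (Γ : Type*) {X : Type*} [Group Γ] [MulAction Γ X] [TopologicalSpace X]
    (A B : Set X) (m : ℕ) : Prop :=
  ∃ (N : ℕ) (U : Fin N → Set X) (g : Fin N → Γ) (c : Fin N → Fin (m + 1)),
    (∀ j, IsOpen (U j)) ∧ (A ⊆ ⋃ j, U j) ∧ (∀ j, g j • U j ⊆ B) ∧
    ∀ j k, j ≠ k → c j = c k → Disjoint (g j • U j) (g k • U k)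

/-- The action `Γ ↷ X` has weak `m`-comparison: `A ≼_m B` whenever `A` is closed, `B` is
open, every point of `A` lies in the orbit of a point of `B`, and the measures of `A` and
`B` under invariant Borel probability measures are uniformly separated. -/
def WeakComparison (Γ X : Type*) [Group Γ] [MulAction Γ X] [TopologicalSpace X]
    [MeasurableSpace X] (m : ℕ) : Prop :=
  ∀ A B : Set X, IsClosed A → IsOpen B →
    (∀ x ∈ A, ∃ g : Γ, ∃ b ∈ B, g • b = x) →
    (∃ a b : ℝ, a < b ∧
      ∀ μ : Measure X, IsProbabilityMeasure μ →
        (∀ g : Γ, Measure.map (fun x : X => g • x) μ = μ) →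
        (μ A).toReal ≤ a ∧ b ≤ (μ B).toReal) →
    SubEquiv Γ A B m

/-- A strengthening of `A ≼_m B` that survives the greedy induction: `R` is covered by finitely
many open sets whose translates of colour `c` have pairwise disjoint closures inside `V c`. -/
def ColouredSubEquiv (Γ : Type*) {X κ : Type*} [Group Γ] [MulAction Γ X] [TopologicalSpace X]
    (R : Set X) (V : κ → Set X) : Prop :=
  ∃ (N : ℕ) (U : Fin N → Set X) (g : Fin N → Γ) (c : Fin N → κ),
    (∀ j, IsOpen (U j)) ∧ (R ⊆ ⋃ j, U j) ∧ (∀ j, closure (g j • U j) ⊆ V (c j)) ∧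
    ∀ j k, j ≠ k → c j = c k → Disjoint (closure (g j • U j)) (closure (g k • U k))

section Greedy

variable {Γ X κ : Type*} [Group Γ] [MulAction Γ X] [TopologicalSpace X]

theorem ColouredSubEquiv.subEquiv {A B : Set X} {m : ℕ}
    (h : ColouredSubEquiv Γ A (fun _ : Fin (m + 1) => B)) : SubEquiv Γ A B m := by
  obtain ⟨N, U, g, c, hU, hA, hB, hdisj⟩ := h
  exact ⟨N, U, g, c, hU, hA, fun j => subset_closure.trans (hB j),
    fun j k hjk hc => (hdisj j k hjk hc).mono subset_closure subset_closure⟩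

variable [NormalSpace X] [ContinuousConstSMul Γ X] [DecidableEq κ]

/-- Moving the part of `R` that `g` sends into `V c` uses up `g • R` inside `V c`. -/
theorem ColouredSubEquiv.step {R : Set X} {V : κ → Set X} (hR : IsClosed R)
    (hV : ∀ c, IsOpen (V c)) (g : Γ) (c : κ)
    (h : ColouredSubEquiv Γ (R \ g⁻¹ • V c) (Function.update V c (V c \ g • R))) :
    ColouredSubEquiv Γ R V := by
  obtain ⟨N, U, γ, χ, hU, hcov, hsub, hdisj⟩ := h
  have hsub' : ∀ j, closure (γ j • U j) ⊆ V (χ j) := by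
    intro j
    refine (hsub j).trans ?_
    by_cases hj : χ j = c
    · subst hj; simp
    · simp [hj]
  have hsubc : ∀ j, χ j = c → Disjoint (closure (γ j • U j)) (g • R) := by
    intro j hj
    have := hsub j
    rw [hj, Function.update_self] at this
    exact Set.disjoint_left.2 fun y hy => (this hy).2
  set E : Set X := R \ ⋃ j, U j with hE
  have hEc : IsClosed E := hR.sdiff (isOpen_iUnion hU)
  set O : Set X := V c \ ⋃ j ∈ {j | χ j = c}, closure (γ j • U j) with hO
  have hOo : IsOpen O :=
    (hV c).sdiff ((Set.toFinite _).isClosed_biUnion fun j _ => isClosed_closure)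
  have hEO : g • E ⊆ O := by
    rintro _ ⟨x, ⟨hxR, hxU⟩, rfl⟩
    refine ⟨?_, ?_⟩
    · by_contra hx
      refine hxU (hcov ⟨hxR, ?_⟩)
      rwa [Set.mem_inv_smul_set_iff]
    · simp only [Set.mem_iUnion, not_exists]
      intro j hj hx
      exact Set.disjoint_left.1 (hsubc j hj) hx (Set.smul_mem_smul_set hxR)
  obtain ⟨W, hWo, hEW, hWO⟩ := normal_exists_closure_subset (hEc.smul g) hOo hEO
  have hWdisj : ∀ j, χ j = c → Disjoint (closure W) (closure (γ j • U j)) := by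
    intro j hj
    refine Set.disjoint_left.2 fun y hy hy' => (hWO hy).2 ?_
    exact Set.mem_biUnion (show j ∈ {j | χ j = c} from hj) hy'
  refine ⟨N + 1, Fin.cons (g⁻¹ • W) U, Fin.cons g γ, Fin.cons c χ, ?_, ?_, ?_, ?_⟩
  · intro j
    refine Fin.cases ?_ (fun j => ?_) j
    · simpa using hWo.smul g⁻¹
    · simpa using hU j
  · intro x hx
    by_cases hxU : x ∈ ⋃ j, U j
    · obtain ⟨j, hj⟩ := Set.mem_iUnion.1 hxU
      exact Set.mem_iUnion.2 ⟨j.succ, by simpa using hj⟩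
    · refine Set.mem_iUnion.2 ⟨0, ?_⟩
      simpa [Set.mem_inv_smul_set_iff] using hEW (Set.smul_mem_smul_set ⟨hx, hxU⟩)
  · intro j
    refine Fin.cases ?_ (fun j => ?_) j
    · simpa using hWO.trans Set.sdiff_subset
    · simpa using hsub' j
  · intro j k
    refine Fin.cases ?_ (fun j => ?_) j <;> refine Fin.cases ?_ (fun k => ?_) k
    · simp
    · intro _ hc
      simpa using hWdisj k (by simpa using hc.symm)
    · intro _ hc
      simpa using (hWdisj j (by simpa using hc)).symm
    · intro hjk hc
      simpa using hdisj j k (by simpa using hjk) (by simpa using hc)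

/-- Running the greedy procedure along a list of moves `(g, c)`: the remainder `Z` is blocked for
all moves, and every used up point `y` of colour `c` is the image under a move of colour `c` of
its own point `σ c y` of `R`. -/
theorem exists_greedy_remainder (l : List (Γ × κ)) (R : Set X) (V : κ → Set X)
    (hR : IsClosed R) (hV : ∀ c, IsOpen (V c)) :
    ∃ (Z : Set X) (W : κ → Set X) (σ : κ → X → X), Z ⊆ R ∧ (∀ c, W c ⊆ V c) ∧
      (∀ p ∈ l, ∀ x ∈ Z, p.1 • x ∉ W p.2) ∧
      (∀ c, ∀ y ∈ V c \ W c, σ c y ∈ R ∧ ∃ g, (g, c) ∈ l ∧ g • σ c y = y) ∧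
      (∀ c, ∀ y ∈ V c \ W c, ∀ c', ∀ y' ∈ V c' \ W c', σ c y = σ c' y' → c = c' ∧ y = y') ∧
      (Z = ∅ → ColouredSubEquiv Γ R V) := by
  induction l generalizing R V with
  | nil =>
    refine ⟨R, V, fun _ y => y, subset_rfl, fun _ => subset_rfl, by simp, by simp, by simp, ?_⟩
    rintro rfl
    exact ⟨0, Fin.elim0, Fin.elim0, Fin.elim0, by simp, by simp, by simp, by simp⟩
  | cons p l ih =>
    obtain ⟨g, c⟩ := p
    have hV' : ∀ k, IsOpen (Function.update V c (V c \ g • R) k) := by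
      intro k
      by_cases hk : k = c
      · subst hk; simpa using (hV k).sdiff (hR.smul g)
      · simpa [hk] using hV k
    obtain ⟨Z, W, σ, hZ, hW, hblock, hσ, hinj, hgood⟩ :=
      ih (R \ g⁻¹ • V c) (Function.update V c (V c \ g • R)) (hR.sdiff ((hV c).smul g⁻¹)) hV'
    have hupd : ∀ k, Function.update V c (V c \ g • R) k ⊆ V k := by
      intro k
      by_cases hk : k = c
      · subst hk; simp
      · simp [hk]
    classical
    -- a used up point was consumed either by the first move or later on
    have hcase : ∀ k, ∀ y ∈ V k \ W k, (k = c ∧ y ∈ g • R) ∨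
        (¬ (k = c ∧ y ∈ g • R) ∧ y ∈ Function.update V c (V c \ g • R) k \ W k) := by
      intro k y hy
      by_cases h : k = c ∧ y ∈ g • R
      · exact Or.inl h
      · refine Or.inr ⟨h, ?_, hy.2⟩
        by_cases hk : k = c
        · subst hk; simpa using ⟨hy.1, fun h' => h ⟨rfl, h'⟩⟩
        · simpa [hk] using hy.1
    refine ⟨Z, W, fun k y => if k = c ∧ y ∈ g • R then g⁻¹ • y else σ k y,
      hZ.trans Set.sdiff_subset, fun k => (hW k).trans (hupd k), ?_, ?_, ?_,
      fun h => ColouredSubEquiv.step hR hV g c (hgood h)⟩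
    · intro p hp x hx
      rcases List.mem_cons.1 hp with rfl | hp
      · intro h
        exact (hZ hx).2 (Set.mem_inv_smul_set_iff.2 (hupd _ (hW _ h)))
      · exact hblock p hp x hx
    · intro k y hy
      rcases hcase k y hy with h | ⟨h, hy'⟩
      · simp only [if_pos h]
        refine ⟨Set.mem_smul_set_iff_inv_smul_mem.1 h.2, g, ?_, by simp⟩
        simp [h.1]
      · simp only [if_neg h]
        obtain ⟨h1, γ, h2, h3⟩ := hσ k y hy'
        exact ⟨h1.1, γ, List.mem_cons_of_mem _ h2, h3⟩
    · have hne : ∀ k y k' y', y ∈ V k \ W k → (k = c ∧ y ∈ g • R) →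
          y' ∈ Function.update V c (V c \ g • R) k' \ W k' → g⁻¹ • y ≠ σ k' y' := by
        intro k y k' y' hy h hy' heq
        apply (hσ k' y' hy').1.2
        rw [← heq]
        exact Set.smul_mem_smul_set (h.1 ▸ hy.1)
      intro k y hy k' y' hy' heq
      rcases hcase k y hy with h | ⟨h, hu⟩ <;> rcases hcase k' y' hy' with h' | ⟨h', hu'⟩
      · simp only [if_pos h, if_pos h'] at heq
        exact ⟨h.1.trans h'.1.symm, MulAction.injective g⁻¹ heq⟩
      · simp only [if_pos h, if_neg h'] at heq
        exact (hne k y k' y' hy h hu' heq).elim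
      · simp only [if_neg h, if_pos h'] at heq
        exact (hne k' y' k y hy' h' hu heq.symm).elim
      · simp only [if_neg h, if_neg h'] at heq
        exact hinj k y hu k' y' hu' heq

end Greedy

/-- If orbit segments meet `B` much more often than they meet `A`, then `A ≼_m B`. -/
theorem subEquiv_of_card_lt {Γ X : Type*} [Group Γ] [MulAction Γ X] [TopologicalSpace X]
    [NormalSpace X] [ContinuousConstSMul Γ X] {A B : Set X} (hA : IsClosed A) (hB : IsOpen B)
    {m : ℕ} (P Q L : Finset Γ) (hPQ : ∀ g ∈ P, ∀ h ∈ P, g⁻¹ * h ∈ Q)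
    (hQL : ∀ g ∈ Q, ∀ h ∈ Q, g * h ∈ L)
    (hcard : ∀ x ∈ A, {g ∈ (L : Set Γ) | g • x ∈ A}.ncard <
      (m + 1) * {g ∈ (P : Set Γ) | g • x ∈ B}.ncard) :
    SubEquiv Γ A B m := by
  classical
  obtain ⟨Z, W, σ, hZ, -, hblock, hσ, hinj, hgood⟩ :=
    exists_greedy_remainder (P ×ˢ (Finset.univ : Finset (Fin (m + 1)))).toList A (fun _ => B) hA
      (fun _ => hB)
  refine (hgood (Set.eq_empty_iff_forall_notMem.2 fun x hx => ?_)).subEquiv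
  have hlt := hcard x (hZ hx)
  have hcoe : ∀ (F : Finset Γ) (D : Set X),
      {g ∈ (F : Set Γ) | g • x ∈ D}.ncard = (F.filter fun g => g • x ∈ D).card := by
    intro F D
    rw [← Set.ncard_coe_finset]
    simp
  rw [hcoe, hcoe] at hlt
  set YB : Finset X := (P.filter fun g => g • x ∈ B).image fun g => g • x with hYB
  set YA : Finset X := (Q.filter fun g => g • x ∈ A).image fun g => g • x with hYA
  set T : Finset Γ := Q.filter fun h => h • x = x with hT
  have hcountB : (P.filter fun g => g • x ∈ B).card ≤ T.card * YB.card := by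
    refine Finset.card_le_mul_card_image _ _ fun b hb => ?_
    obtain ⟨g₀, hg₀, rfl⟩ := Finset.mem_image.1 hb
    refine Finset.card_le_card_of_injOn (fun g => g₀⁻¹ * g) ?_
      ((mul_right_injective _).injOn)
    intro g hg
    simp only [Finset.coe_filter, Finset.mem_filter, Set.mem_ofPred_eq] at hg hg₀
    simp only [hT, Finset.coe_filter, Set.mem_ofPred_eq]
    exact ⟨hPQ _ hg₀.1 _ hg.1.1, by rw [mul_smul, hg.2, inv_smul_smul]⟩
  have hcountA : T.card * YA.card ≤ (L.filter fun g => g • x ∈ A).card := by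
    refine (Finset.mul_card_image_le_card_of_maps_to (s := L.filter fun g => g • x ∈ YA)
      (f := fun g => g • x) (fun g hg => (Finset.mem_filter.1 hg).2) _ fun b hb => ?_).trans
      (Finset.card_le_card ?_)
    · obtain ⟨g₀, hg₀, rfl⟩ := Finset.mem_image.1 hb
      refine Finset.card_le_card_of_injOn (fun g => g₀ * g) ?_
        ((mul_right_injective _).injOn)
      intro g hg
      simp only [hT, Finset.coe_filter, Set.mem_ofPred_eq] at hg
      have hx' : (g₀ * g) • x = g₀ • x := by rw [mul_smul, hg.2]
      simp only [Finset.coe_filter, Finset.mem_filter, Set.mem_ofPred_eq, hx']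
      exact ⟨⟨hQL _ (Finset.mem_filter.1 hg₀).1 _ hg.1, hb⟩, trivial⟩
    · intro g hg
      obtain ⟨hgL, hgY⟩ := Finset.mem_filter.1 hg
      obtain ⟨g₀, hg₀, h⟩ := Finset.mem_image.1 hgY
      exact Finset.mem_filter.2 ⟨hgL, h ▸ (Finset.mem_filter.1 hg₀).2⟩
  have hYBmem : ∀ y ∈ YB, ∀ c, y ∈ B \ W c := by
    intro y hy c
    obtain ⟨g, hg, rfl⟩ := Finset.mem_image.1 hy
    refine ⟨(Finset.mem_filter.1 hg).2, hblock (g, c) ?_ x hx⟩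
    simpa using (Finset.mem_filter.1 hg).1
  have hinject : (m + 1) * YB.card ≤ YA.card := by
    have : ((Finset.univ : Finset (Fin (m + 1))) ×ˢ YB).card ≤ YA.card := by
      refine Finset.card_le_card_of_injOn (fun p => σ p.1 p.2) ?_ ?_
      · rintro ⟨c, y⟩ hp
        have hy : y ∈ YB := by simpa using hp
        obtain ⟨h1, g, h2, h3⟩ := hσ c y (hYBmem y hy c)
        obtain ⟨g₀, hg₀, h4⟩ := Finset.mem_image.1 hy
        have hg : g ∈ P := by simpa using h2
        have h5 : (g⁻¹ * g₀) • x = σ c y := by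
          rw [mul_smul, h4, inv_smul_eq_iff, h3]
        simp only [hYA, Finset.coe_image, Set.mem_image, Finset.mem_coe, Finset.mem_filter]
        exact ⟨g⁻¹ * g₀, ⟨hPQ _ hg _ (Finset.mem_filter.1 hg₀).1, h5 ▸ h1⟩, h5⟩
      · rintro ⟨c, y⟩ hp ⟨c', y'⟩ hp' heq
        have hy : y ∈ YB := by simpa using hp
        have hy' : y' ∈ YB := by simpa using hp'
        obtain ⟨h1, h2⟩ := hinj c y (hYBmem y hy c) c' y' (hYBmem y' hy' c') heq
        rw [h1, h2]
    simpa using this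
  have : (m + 1) * (P.filter fun g => g • x ∈ B).card ≤ (L.filter fun g => g • x ∈ A).card :=
    calc (m + 1) * (P.filter fun g => g • x ∈ B).card
        ≤ (m + 1) * (T.card * YB.card) := Nat.mul_le_mul_left _ hcountB
      _ = T.card * ((m + 1) * YB.card) := by ring
      _ ≤ T.card * YA.card := Nat.mul_le_mul_left _ hinject
      _ ≤ _ := hcountA
  omega

section Empirical

open Filter Topology

variable {Γ X : Type*} [Group Γ] [MulAction Γ X]

/-- Averages over an almost invariant set are almost invariant. -/
theorem abs_sum_smul_sub_sum_le [DecidableEq Γ] (F : Finset Γ) (t : Γ) (x : X) (f : X → ℝ)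
    {K : ℝ} (hf : ∀ y, |f y| ≤ K) :
    |∑ g ∈ F, f (t • g • x) - ∑ g ∈ F, f (g • x)| ≤ 2 * K * (t • F \ F).card := by
  have h1 : ∑ g ∈ F, f (t • g • x) = ∑ g ∈ t • F, f (g • x) := by
    rw [Finset.smul_finset_def, Finset.sum_image (MulAction.injective t).injOn]
    simp [mul_smul]
  have h2 : (F \ t • F).card = (t • F \ F).card :=
    Finset.card_sdiff_comm (Finset.card_smul_finset t F).symm
  have hb : ∀ G : Finset Γ, |∑ g ∈ G, f (g • x)| ≤ G.card * K := fun G =>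
    (Finset.abs_sum_le_sum_abs _ _).trans
      ((Finset.sum_le_card_nsmul _ _ _ fun g _ => hf _).trans_eq (nsmul_eq_mul _ _))
  rw [h1, ← Finset.sum_sdiff_sub_sum_sdiff]
  refine (abs_sub _ _).trans ?_
  have := hb (t • F \ F)
  have := hb (F \ t • F)
  rw [h2] at this
  linarith

variable [MeasurableSpace X]

/-- The uniform distribution on the orbit segment `{g • x | g ∈ F}`, with multiplicity. -/
noncomputable def empiricalMeasure (F : Finset Γ) (x : X) : Measure X :=
  (F.card : ENNReal)⁻¹ • ∑ g ∈ F, Measure.dirac (g • x)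

theorem isProbabilityMeasure_empiricalMeasure {F : Finset Γ} (hF : F.Nonempty) (x : X) :
    IsProbabilityMeasure (empiricalMeasure F x) := by
  constructor
  have : (F.card : ENNReal) ≠ 0 := by simpa using hF.ne_empty
  simp [empiricalMeasure, ENNReal.inv_mul_cancel this]

theorem integral_empiricalMeasure [TopologicalSpace X] [BorelSpace X] (F : Finset Γ) (x : X)
    (f : BoundedContinuousFunction X ℝ) :
    ∫ y, f y ∂(empiricalMeasure F x) = (F.card : ℝ)⁻¹ * ∑ g ∈ F, f (g • x) := by
  rw [empiricalMeasure, integral_smul_measure, integral_finsetSum_measure]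
  · simp [integral_dirac' _ _ f.continuous.stronglyMeasurable]
  · intro g _
    exact f.integrable _

theorem empiricalMeasure_apply_toReal (F : Finset Γ) (x : X) {D : Set X} (hD : MeasurableSet D) :
    (empiricalMeasure F x D).toReal =
      (F.card : ℝ)⁻¹ * {g ∈ (F : Set Γ) | g • x ∈ D}.ncard := by
  classical
  have : {g ∈ (F : Set Γ) | g • x ∈ D}.ncard = (F.filter fun g => g • x ∈ D).card := by
    rw [← Set.ncard_coe_finset]
    simp
  rw [this, empiricalMeasure]
  simp [Measure.dirac_apply' _ hD, Set.indicator_apply, Finset.sum_boole]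

theorem map_smul_eq_of_generators [TopologicalSpace X] [BorelSpace X] [ContinuousConstSMul Γ X]
    {S : Set Γ} (hgen : Subgroup.closure S = ⊤) {μ : Measure X}
    (h : ∀ t ∈ S, Measure.map (fun x : X => t • x) μ = μ) (g : Γ) :
    Measure.map (fun x : X => g • x) μ = μ := by
  have hmeas : ∀ g : Γ, Measurable fun x : X => g • x := fun g =>
    (continuous_const_smul g).measurable
  have hg : g ∈ Subgroup.closure S := hgen ▸ Subgroup.mem_top g
  induction hg using Subgroup.closure_induction with
  | mem t ht => exact h t ht
  | one => simp
  | mul a b _ _ ha hb =>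
    have : (fun x : X => (a * b) • x) = (fun x => a • x) ∘ fun x => b • x := by
      ext x; simp [mul_smul]
    rw [this, ← Measure.map_map (hmeas a) (hmeas b), hb, ha]
  | inv a _ ha =>
    conv_lhs => rw [← ha]
    rw [Measure.map_map (hmeas _) (hmeas a)]
    simp [Function.comp_def]

/-- A uniform upper bound on the measure of a closed set passes to orbit frequencies along
sufficiently invariant finite sets. -/
theorem exists_invariance_forall_card_le [TopologicalSpace X] [BorelSpace X] [CompactSpace X]
    [TopologicalSpace.MetrizableSpace X] [ContinuousConstSMul Γ X] [DecidableEq Γ]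
    {S : Set Γ} (hgen : Subgroup.closure S = ⊤) {D : Set X} (hD : IsClosed D) {a a' : ℝ}
    (haa' : a < a')
    (hμ : ∀ μ : Measure X, IsProbabilityMeasure μ →
      (∀ g : Γ, Measure.map (fun x : X => g • x) μ = μ) → (μ D).toReal ≤ a) :
    ∃ δ > 0, ∀ F : Finset Γ, F.Nonempty →
      (∀ t ∈ S, ((t • F \ F).card : ℝ) ≤ δ * F.card) →
      ∀ x : X, ({g ∈ (F : Set Γ) | g • x ∈ D}.ncard : ℝ) ≤ a' * F.card := by
  let _ := TopologicalSpace.metrizableSpaceMetric X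
  by_contra! hcon
  choose F hF hinv x hx using fun n : ℕ => hcon (1 / ((n : ℝ) + 1)) (by positivity)
  have hpos : ∀ n, (0 : ℝ) < (F n).card := fun n => by exact_mod_cast (hF n).card_pos
  let μs : ℕ → ProbabilityMeasure X := fun n =>
    ⟨empiricalMeasure (F n) (x n), isProbabilityMeasure_empiricalMeasure (hF n) _⟩
  let 𝓤 : Ultrafilter ℕ := hyperfilter ℕ
  have h𝓤 : (𝓤 : Filter ℕ) ≤ atTop := Nat.hyperfilter_le_atTop
  obtain ⟨μ, hlim⟩ : ∃ μ, Tendsto μs 𝓤 (𝓝 μ) :=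
    ⟨(𝓤.map μs).lim, (𝓤.map μs).le_nhds_lim⟩
  have hint := ProbabilityMeasure.tendsto_iff_forall_integral_tendsto.1 hlim
  have hinvar : ∀ g : Γ, Measure.map (fun x : X => g • x) (μ : Measure X) = μ := by
    refine map_smul_eq_of_generators hgen fun t ht => ?_
    have hmeas : Measurable fun x : X => t • x := (continuous_const_smul t).measurable
    have : IsProbabilityMeasure (Measure.map (fun x : X => t • x) (μ : Measure X)) :=
      Measure.isProbabilityMeasure_map hmeas.aemeasurable
    refine ext_of_forall_integral_eq_of_IsFiniteMeasure fun f => ?_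
    rw [integral_map hmeas.aemeasurable f.continuous.aestronglyMeasurable]
    let ft : BoundedContinuousFunction X ℝ :=
      f.compContinuous ⟨fun x => t • x, continuous_const_smul t⟩
    have hsub := (hint ft).sub (hint f)
    have hzero : Tendsto (fun n => ∫ y, ft y ∂(μs n : Measure X) - ∫ y, f y ∂(μs n : Measure X))
        𝓤 (𝓝 0) := by
      have hle : Tendsto (fun n : ℕ => 2 * ‖f‖ * (1 / ((n : ℝ) + 1))) 𝓤 (𝓝 0) := by
        simpa using (tendsto_one_div_add_atTop_nhds_zero_nat (𝕜 := ℝ)).const_mul (2 * ‖f‖)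
          |>.mono_left h𝓤
      refine squeeze_zero_norm (fun n => ?_) hle
      have e1 : ∫ y, ft y ∂(μs n : Measure X) =
          ((F n).card : ℝ)⁻¹ * ∑ g ∈ F n, ft (g • x n) := integral_empiricalMeasure _ _ _
      have e2 : ∫ y, f y ∂(μs n : Measure X) =
          ((F n).card : ℝ)⁻¹ * ∑ g ∈ F n, f (g • x n) := integral_empiricalMeasure _ _ _
      rw [e1, e2, ← mul_sub, Real.norm_eq_abs, abs_mul, abs_of_pos (inv_pos.2 (hpos n)),
        inv_mul_le_iff₀ (hpos n)]
      calc |∑ g ∈ F n, ft (g • x n) - ∑ g ∈ F n, f (g • x n)|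
          ≤ 2 * ‖f‖ * (t • F n \ F n).card :=
            abs_sum_smul_sub_sum_le (F n) t (x n) f fun y => f.norm_coe_le_norm y
        _ ≤ 2 * ‖f‖ * (1 / ((n : ℝ) + 1) * (F n).card) := by
            gcongr
            exact hinv n t ht
        _ = _ := by ring
    have := tendsto_nhds_unique hsub hzero
    exact sub_eq_zero.1 this
  have hlow : ENNReal.ofReal a' ≤ (μ : Measure X) D := by
    refine le_trans ?_ (ProbabilityMeasure.limsup_measure_closed_le_of_tendsto hlim hD)
    refine le_limsup_of_frequently_le (Eventually.frequently (Eventually.of_forall fun n => ?_))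
    rw [ENNReal.ofReal_le_iff_le_toReal (measure_ne_top _ _)]
    have e : ((μs n : Measure X) D).toReal = _ :=
      empiricalMeasure_apply_toReal (F n) (x n) hD.measurableSet
    rw [e, le_inv_mul_iff₀ (hpos n)]
    linarith [hx n]
  have hup := hμ μ inferInstance hinvar
  have := (ENNReal.ofReal_le_iff_le_toReal (measure_ne_top _ _)).1 hlow
  linarith

end Empirical

section WordBall

variable {Γ : Type*} [Group Γ] {S : Set Γ}

theorem one_mem_wordBall (S : Set Γ) (n : ℕ) : (1 : Γ) ∈ wordBall S n :=
  ⟨[], by simp, by simp, rfl⟩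

theorem wordBall_mono (S : Set Γ) : Monotone (wordBall S) := by
  rintro n k hnk _ ⟨l, hl, hlen, rfl⟩
  exact ⟨l, hl, hlen.trans hnk, rfl⟩

theorem mul_mem_wordBall {n k : ℕ} {g h : Γ} (hg : g ∈ wordBall S n) (hh : h ∈ wordBall S k) :
    g * h ∈ wordBall S (n + k) := by
  obtain ⟨l, hl, hlen, rfl⟩ := hg
  obtain ⟨l', hl', hlen', rfl⟩ := hh
  refine ⟨l ++ l', ?_, by simp; omega, by simp⟩
  intro x hx
  exact (List.mem_append.1 hx).elim (hl x) (hl' x)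

theorem inv_mem_wordBall (hsym : S⁻¹ = S) {n : ℕ} {g : Γ} (hg : g ∈ wordBall S n) :
    g⁻¹ ∈ wordBall S n := by
  obtain ⟨l, hl, hlen, rfl⟩ := hg
  refine ⟨(l.map (·⁻¹)).reverse, ?_, by simpa using hlen, (List.prod_inv_reverse l).symm⟩
  intro x hx
  simp only [List.mem_reverse, List.mem_map] at hx
  obtain ⟨y, hy, rfl⟩ := hx
  rw [← hsym]
  exact Set.inv_mem_inv.2 (hl y hy)

theorem mem_wordBall_one {t : Γ} (ht : t ∈ S) : t ∈ wordBall S 1 :=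
  ⟨[t], by simpa using ht, by simp, by simp⟩

theorem finite_wordBall (hfin : S.Finite) (n : ℕ) : (wordBall S n).Finite := by
  induction n with
  | zero =>
    refine (Set.finite_singleton (1 : Γ)).subset ?_
    rintro _ ⟨l, -, hlen, rfl⟩
    simp [List.length_eq_zero_iff.1 (Nat.le_zero.1 hlen)]
  | succ n ih =>
    refine ((Set.finite_singleton (1 : Γ)).union (hfin.mul ih)).subset ?_
    rintro _ ⟨l, hl, hlen, rfl⟩
    cases l with
    | nil => simp
    | cons a l =>
      refine Or.inr ⟨a, hl a (by simp), l.prod, ⟨l, fun x hx => hl x (by simp [hx]), ?_, rfl⟩, ?_⟩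
      · simpa using hlen
      · simp

/-- A ball whose size barely grows in the next step is almost invariant under the generators. -/
theorem card_smul_sdiff_wordBall_le [DecidableEq Γ] (hfin : S.Finite) {r : ℕ} {δ : ℝ}
    (hr : ((wordBall S (r + 1)).ncard : ℝ) ≤ (1 + δ) * (wordBall S r).ncard) {t : Γ}
    (ht : t ∈ S) :
    ((t • (finite_wordBall hfin r).toFinset \ (finite_wordBall hfin r).toFinset).card : ℝ) ≤
      δ * (finite_wordBall hfin r).toFinset.card := by
  set F := (finite_wordBall hfin r).toFinset with hF
  set F' := (finite_wordBall hfin (r + 1)).toFinset with hF'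
  have h1 : F ⊆ F' := by
    intro g hg
    simp only [hF, hF', Set.Finite.mem_toFinset] at hg ⊢
    exact wordBall_mono S (Nat.le_succ r) hg
  have h2 : t • F ⊆ F' := by
    intro g hg
    obtain ⟨h, hh, rfl⟩ := Finset.mem_smul_finset.1 hg
    simp only [hF, hF', Set.Finite.mem_toFinset] at hh ⊢
    rw [add_comm]
    exact mul_mem_wordBall (mem_wordBall_one ht) hh
  rw [Set.ncard_eq_toFinset_card _ (finite_wordBall hfin r),
    Set.ncard_eq_toFinset_card _ (finite_wordBall hfin (r + 1)), ← hF, ← hF'] at hr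
  have h3 : (t • F \ F).card + F.card ≤ F'.card := by
    rw [← Finset.card_sdiff_add_card_eq_card h1]
    exact Nat.add_le_add_right (Finset.card_le_card (Finset.sdiff_subset_sdiff h2 subset_rfl)) _
  have h4 : ((t • F \ F).card : ℝ) + F.card ≤ F'.card := by exact_mod_cast h3
  linarith

end WordBall

section Growth

theorem exists_slow_step {v : ℕ → ℝ} {n k : ℕ} {K δ : ℝ} (hδ : 0 < δ) (hpos : 0 < v n)
    (hK : v (n + k) ≤ K * v n) (hk : K < (1 + δ) ^ k) :
    ∃ r, n ≤ r ∧ r < n + k ∧ v (r + 1) ≤ (1 + δ) * v r := by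
  by_contra! hcon
  have h : ∀ j ≤ k, (1 + δ) ^ j * v n ≤ v (n + j) := by
    intro j hj
    induction j with
    | zero => simp
    | succ j ih =>
      calc (1 + δ) ^ (j + 1) * v n = (1 + δ) * ((1 + δ) ^ j * v n) := by ring
        _ ≤ (1 + δ) * v (n + j) := by gcongr; exact ih (by omega)
        _ ≤ v (n + (j + 1)) := (hcon (n + j) (by omega) (by omega)).le
  have := (h k le_rfl).trans hK
  exact absurd (le_of_mul_le_mul_right this hpos) (not_le.2 hk)

theorem exists_doubling_scale {v : ℕ → ℝ} (hone : ∀ n, 1 ≤ v n) {C d : ℝ}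
    (hv : ∀ n : ℕ, 1 ≤ n → v n ≤ C * (n : ℝ) ^ d) (n₀ : ℕ) :
    ∃ n, n₀ ≤ n ∧ v (16 * n) ≤ (16 : ℝ) ^ (d + 1) * v n := by
  by_contra! hcon
  set N := n₀ + 1 with hN
  have hgrow : ∀ j : ℕ, ((16 : ℝ) ^ (d + 1)) ^ j ≤ v (16 ^ j * N) := by
    intro j
    induction j with
    | zero => simpa using hone _
    | succ j ih =>
      have hle : n₀ ≤ 16 ^ j * N :=
        (Nat.le_succ n₀).trans (Nat.le_mul_of_pos_left _ (by positivity))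
      have := (hcon _ hle).le
      calc ((16 : ℝ) ^ (d + 1)) ^ (j + 1) = (16 : ℝ) ^ (d + 1) * ((16 : ℝ) ^ (d + 1)) ^ j := by
            ring
        _ ≤ (16 : ℝ) ^ (d + 1) * v (16 ^ j * N) := by gcongr
        _ ≤ v (16 * (16 ^ j * N)) := this
        _ = v (16 ^ (j + 1) * N) := by ring_nf
  have hbound : ∀ j : ℕ, (16 : ℝ) ^ j ≤ C * (N : ℝ) ^ d := by
    intro j
    have h1 := (hgrow j).trans (hv (16 ^ j * N) (Nat.one_le_iff_ne_zero.2 (by positivity)))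
    have h2 : ((16 : ℝ) ^ (d + 1)) ^ j = (16 : ℝ) ^ j * ((16 : ℝ) ^ j) ^ d := by
      rw [Real.rpow_add_one (by norm_num), mul_pow, ← Real.rpow_mul_natCast (by norm_num),
        ← Real.rpow_natCast_mul (by norm_num), mul_comm d, mul_comm]
    have h3 : (((16 ^ j * N : ℕ) : ℝ)) ^ d = ((16 : ℝ) ^ j) ^ d * (N : ℝ) ^ d := by
      push_cast
      rw [Real.mul_rpow (by positivity) (by positivity)]
    rw [h2, h3] at h1
    have hp : (0 : ℝ) < ((16 : ℝ) ^ j) ^ d := by positivity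
    refine le_of_mul_le_mul_right ?_ hp
    linarith
  obtain ⟨j, hj⟩ := pow_unbounded_of_one_lt (C * (N : ℝ) ^ d) (by norm_num : (1 : ℝ) < 16)
  exact absurd (hbound j) (not_le.2 hj)

/-- Polynomial growth yields, at arbitrarily slow growth rates `δ`, two comparable scales. -/
theorem exists_slow_scales {v : ℕ → ℝ} (hmono : Monotone v) (hone : ∀ n, 1 ≤ v n) {C d : ℝ}
    (hv : ∀ n : ℕ, 1 ≤ n → v n ≤ C * (n : ℝ) ^ d) {δ : ℝ} (hδ : 0 < δ) :
    ∃ r s, 4 * r ≤ s ∧ v (r + 1) ≤ (1 + δ) * v r ∧ v (s + 1) ≤ (1 + δ) * v s ∧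
      v s ≤ (16 : ℝ) ^ (d + 1) * v r := by
  set K := (16 : ℝ) ^ (d + 1) with hK
  obtain ⟨n₀, hn₀⟩ := pow_unbounded_of_one_lt K (by linarith : 1 < 1 + δ)
  obtain ⟨n, hn, hdbl⟩ := exists_doubling_scale hone hv n₀
  have hK0 : 0 ≤ K := by positivity
  have hpow : ∀ k, n₀ ≤ k → K < (1 + δ) ^ k := fun k hk =>
    hn₀.trans_le (pow_le_pow_right₀ (by linarith) hk)
  have hpos : ∀ k, 0 < v k := fun k => zero_lt_one.trans_le (hone k)
  obtain ⟨r, hr1, hr2, hr3⟩ := exists_slow_step (n := n) (k := n) hδ (hpos n)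
    ((hmono (by omega)).trans hdbl) (hpow n hn)
  obtain ⟨s, hs1, hs2, hs3⟩ := exists_slow_step (n := 8 * n) (k := 8 * n) hδ (hpos _)
    ((hmono (by omega : 8 * n + 8 * n ≤ 16 * n)).trans (hdbl.trans
      (mul_le_mul_of_nonneg_left (hmono (by omega : n ≤ 8 * n)) hK0))) (hpow _ (by omega))
  refine ⟨r, s, by omega, hr3, hs3, ?_⟩
  exact (hmono (by omega : s ≤ 16 * n)).trans
    (hdbl.trans (mul_le_mul_of_nonneg_left (hmono hr1) hK0))

end Growth

/-- Actions of groups of polynomial growth on compact metrizable spaces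
have weak `m`-comparison for some `m`. -/
theorem polynomial_growth_weak_comparison {Γ : Type*} [Group Γ]
    (S : Set Γ) (hfin : S.Finite) (hsym : S⁻¹ = S) (hgen : Subgroup.closure S = ⊤)
    (C d : ℝ) (hC : 0 < C) (hd : 0 ≤ d)
    (hpoly : ∀ n : ℕ, 1 ≤ n → ((wordBall S n).ncard : ℝ) ≤ C * (n : ℝ) ^ d)
    {X : Type*} [TopologicalSpace X] [CompactSpace X]
    [TopologicalSpace.MetrizableSpace X] [MeasurableSpace X] [BorelSpace X]
    [MulAction Γ X] (hcont : ∀ g : Γ, Continuous fun x : X => g • x) :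
    ∃ m : ℕ, WeakComparison Γ X m := by
  classical
  have : ContinuousConstSMul Γ X := ⟨hcont⟩
  refine ⟨⌈(16 : ℝ) ^ (d + 1)⌉₊, fun A B hA hB _ ⟨a, b, hab, hμ⟩ => ?_⟩
  set m := ⌈(16 : ℝ) ^ (d + 1)⌉₊ with hm
  set a' := (2 * a + b) / 3 with ha'
  set b' := (a + 2 * b) / 3 with hb'
  obtain ⟨δ₁, hδ₁, hfreqA⟩ := exists_invariance_forall_card_le hgen hA
    (by linarith : a < a') fun μ h1 h2 => (hμ μ h1 h2).1
  obtain ⟨δ₂, hδ₂, hfreqB⟩ := exists_invariance_forall_card_le hgen hB.isClosed_compl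
    (by linarith : 1 - b < 1 - b') fun μ h1 h2 => by
      have h3 := (hμ μ h1 h2).2
      have h4 : (μ Bᶜ).toReal = 1 - (μ B).toReal := probReal_compl_eq_one_sub hB.measurableSet
      linarith
  have hfinite := finite_wordBall (S := S) hfin
  have hpos : ∀ n, 1 ≤ (wordBall S n).ncard := fun n =>
    (Set.ncard_pos (hfinite n)).2 ⟨1, one_mem_wordBall S n⟩
  obtain ⟨r, s, hrs, hr, hs, hsr⟩ := exists_slow_scales
    (v := fun n => ((wordBall S n).ncard : ℝ))
    (fun n k hnk => by
      simpa using Set.ncard_le_ncard (wordBall_mono S hnk) (hfinite k))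
    (fun n => by exact_mod_cast hpos n) hpoly (lt_min hδ₁ hδ₂)
  have hcard : ∀ n, (hfinite n).toFinset.card = (wordBall S n).ncard := fun n =>
    (Set.ncard_eq_toFinset_card _ (hfinite n)).symm
  have hne : ∀ n, (hfinite n).toFinset.Nonempty := fun n =>
    ⟨1, (hfinite n).mem_toFinset.2 (one_mem_wordBall S n)⟩
  refine subEquiv_of_card_lt hA hB (hfinite r).toFinset (hfinite (r + r)).toFinset
    (hfinite s).toFinset ?_ ?_ fun x hx => ?_
  · intro g hg h hh
    simp only [Set.Finite.mem_toFinset] at hg hh ⊢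
    exact mul_mem_wordBall (inv_mem_wordBall hsym hg) hh
  · intro g hg h hh
    simp only [Set.Finite.mem_toFinset] at hg hh ⊢
    exact wordBall_mono S (by omega) (mul_mem_wordBall hg hh)
  have hs0 : (1 : ℝ) ≤ (wordBall S s).ncard := by exact_mod_cast hpos s
  have hr0 : (1 : ℝ) ≤ (wordBall S r).ncard := by exact_mod_cast hpos r
  have hA' := hfreqA (hfinite s).toFinset (hne s) (fun t ht =>
    (card_smul_sdiff_wordBall_le hfin hs ht).trans (by gcongr; exact min_le_left _ _)) x
  have hB' := hfreqB (hfinite r).toFinset (hne r) (fun t ht =>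
    (card_smul_sdiff_wordBall_le hfin hr ht).trans (by gcongr; exact min_le_right _ _)) x
  rw [hcard] at hA' hB'
  set NA := {g ∈ ((hfinite s).toFinset : Set Γ) | g • x ∈ A}.ncard
  set NB := {g ∈ ((hfinite r).toFinset : Set Γ) | g • x ∈ B}.ncard with hNB
  have hsplit : NB + {g ∈ ((hfinite r).toFinset : Set Γ) | g • x ∈ Bᶜ}.ncard =
      (wordBall S r).ncard := by
    rw [hNB, ← hcard r, ← Set.ncard_coe_finset]
    exact Set.ncard_inter_add_ncard_sdiff_eq_ncard _ {g : Γ | g • x ∈ B} (Finset.finite_toSet _)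
  have hsplit' : (NB : ℝ) + {g ∈ ((hfinite r).toFinset : Set Γ) | g • x ∈ Bᶜ}.ncard =
      (wordBall S r).ncard := by exact_mod_cast hsplit
  have ha0 : 0 ≤ a' := by
    have : 0 ≤ a' * (wordBall S s).ncard := (Nat.cast_nonneg NA).trans hA'
    exact nonneg_of_mul_nonneg_left this (by linarith)
  have hab' : a' < b' := by linarith
  have hmK : (16 : ℝ) ^ (d + 1) ≤ m := Nat.le_ceil _
  have hfinal : (NA : ℝ) < (m + 1) * NB :=
    calc (NA : ℝ) ≤ a' * (wordBall S s).ncard := hA'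
      _ < b' * (wordBall S s).ncard := by gcongr
      _ ≤ b' * ((16 : ℝ) ^ (d + 1) * (wordBall S r).ncard) := by gcongr; linarith
      _ = (16 : ℝ) ^ (d + 1) * (b' * (wordBall S r).ncard) := by ring
      _ ≤ (m + 1) * NB := mul_le_mul (by linarith) (by linarith)
          (mul_nonneg (ha0.trans hab'.le) (by linarith)) (by positivity)
  exact_mod_cast hfinal
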